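/- arXiv:0708.4094 — 2 statements merged into one kernel-verified Lean document; each statement's English description precedes it below -/
import Mathlib

section
/- For any positive trace-one operator S on L²(ℝ), the set function Z ↦ E^S(Z) := (1/2π)∫_Z W(q,p) S W(q,p)* dq dp (weak integral over Borel sets Z ⊆ ℝ²) defines a positive-operator-valued measure on the Borel σ-algebra of ℝ² with E^S(ℝ²) = I. -/
open MeasureTheory
open scoped ComplexInnerProductSpace

/-- The Weyl operator `W(q,p) = e^{iqp/2} e^{−iqP} e^{ipQ}` acting on functions:
`(W(q,p)ψ)(x) = e^{iqp/2} e^{ip(x−q)} ψ(x−q)`. -/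
noncomputable def weylOp (q p : ℝ) (ψ : ℝ → ℂ) : ℝ → ℂ := fun x =>
  Complex.exp (Complex.I * q * p / 2) * Complex.exp (Complex.I * p * (x - q)) * ψ (x - q)

open scoped FourierTransform ENNReal SchwartzMap ContDiff

section Plancherel

variable {V F : Type*} [NormedAddCommGroup V] [InnerProductSpace ℝ V] [FiniteDimensional ℝ V]
  [MeasurableSpace V] [BorelSpace V] [NormedAddCommGroup F] [InnerProductSpace ℂ F]
  [CompleteSpace F]

/-- The `L²` Fourier transform of an integrable function is given by the Fourier integral. -/
lemma fourier_toLp_ae_eq {f : V → F} (hf : Integrable f) (hf2 : MemLp f 2) :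
    (𝓕 (hf2.toLp f) : Lp F 2 (volume : Measure V)) =ᵐ[volume] 𝓕 f := by
  have hcont : Continuous (𝓕 f) :=
    VectorFourier.fourierIntegral_continuous Real.continuous_fourierChar
      (L := innerₗ V) continuous_inner hf
  refine ae_eq_of_integral_contDiff_smul_eq
    ((Lp.memLp _).locallyIntegrable one_le_two) hcont.locallyIntegrable ?_
  intro g hg hgc
  have hg₁ : HasCompactSupport (Complex.ofRealCLM ∘ g) := hgc.comp_left rfl
  have hg₂ : ContDiff ℝ ∞ (Complex.ofRealCLM ∘ g) := by fun_prop
  set G : 𝓢(V, ℂ) := hg₁.toSchwartzMap hg₂ with hG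
  have hGint : Integrable G := G.integrable
  have key := VectorFourier.integral_fourierIntegral_smul_eq_flip (L := innerₗ V)
    (μ := volume) (ν := volume) Real.continuous_fourierChar continuous_inner hGint hf
  rw [flip_innerₗ] at key
  calc ∫ x, g x • (𝓕 (hf2.toLp f) : Lp F 2 (volume : Measure V)) x
      = ((𝓕 (hf2.toLp f) : Lp F 2 (volume : Measure V)) : 𝓢'(V, F)) G := by
        rw [Lp.toTemperedDistribution_apply]; simp [hG]
    _ = ∫ x, (𝓕 G) x • (hf2.toLp f) x := by
        rw [← Lp.fourier_toTemperedDistribution_eq, TemperedDistribution.fourier_apply,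
          Lp.toTemperedDistribution_apply]
    _ = ∫ x, 𝓕 (G : V → ℂ) x • f x := by
        refine integral_congr_ae ?_
        filter_upwards [hf2.coeFn_toLp] with x hx
        rw [hx, SchwartzMap.fourier_coe]
    _ = ∫ x, G x • 𝓕 f x := key
    _ = ∫ x, g x • 𝓕 f x := by simp [hG]

lemma eLpNorm_two_sq {α E : Type*} [MeasurableSpace α] [NormedAddCommGroup E] (μ : Measure α)
    (f : α → E) : eLpNorm f 2 μ ^ 2 = ∫⁻ x, ‖f x‖ₑ ^ 2 ∂μ := by
  simpa using eLpNorm_nnreal_pow_eq_lintegral (p := 2) (f := f) (μ := μ) two_ne_zero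

/-- Plancherel's theorem for integrable functions. -/
lemma lintegral_enorm_fourier_sq {f : V → F} (hf : Integrable f) (hf2 : MemLp f 2) :
    ∫⁻ w, ‖𝓕 f w‖ₑ ^ 2 = ∫⁻ v, ‖f v‖ₑ ^ 2 := by
  have h : ‖(𝓕 (hf2.toLp f) : Lp F 2 (volume : Measure V))‖ₑ = ‖hf2.toLp f‖ₑ := by
    rw [← ofReal_norm, ← ofReal_norm, Lp.norm_fourier_eq]
  rw [Lp.enorm_def, Lp.enorm_def, eLpNorm_congr_ae (fourier_toLp_ae_eq hf hf2),
    eLpNorm_congr_ae hf2.coeFn_toLp] at h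
  rw [← eLpNorm_two_sq, ← eLpNorm_two_sq, h]

end Plancherel

lemma lintegral_comp_div (f : ℝ → ℝ≥0∞) {c : ℝ} (hc : 0 < c) :
    ∫⁻ x, f (x / c) = ENNReal.ofReal c * ∫⁻ x, f x := by
  have hemb : MeasurableEmbedding (fun x : ℝ => c⁻¹ * x) :=
    (Homeomorph.mulLeft₀ c⁻¹ (inv_ne_zero hc.ne')).measurableEmbedding
  have h := hemb.lintegral_map (μ := volume) f
  rw [Real.map_volume_mul_left (inv_ne_zero hc.ne'), lintegral_smul_measure, inv_inv,
    abs_of_pos hc] at h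
  simp only [div_eq_inv_mul]
  exact h.symm

/-- The matrix coefficients of the Weyl operators are Fourier integrals. -/
lemma enorm_integral_conj_weylOp_mul (q p : ℝ) (ψ φ : ℝ → ℂ) :
    ‖∫ x, φ x * (starRingEnd ℂ) (weylOp q p ψ x)‖ₑ =
      ‖𝓕 (fun x => φ x * (starRingEnd ℂ) (ψ (x - q))) (p / (2 * Real.pi))‖ₑ := by
  have hx : ∀ x : ℝ, φ x * (starRingEnd ℂ) (weylOp q p ψ x) =
      Complex.exp ((q * p / 2 : ℝ) * Complex.I) *
        (Complex.exp (((-2 * Real.pi * x * (p / (2 * Real.pi)) : ℝ) : ℂ) * Complex.I) •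
          (φ x * (starRingEnd ℂ) (ψ (x - q)))) := by
    intro x
    have hexp : (starRingEnd ℂ) (Complex.exp (Complex.I * q * p / 2)) *
        (starRingEnd ℂ) (Complex.exp (Complex.I * p * (x - q))) =
        Complex.exp ((q * p / 2 : ℝ) * Complex.I) *
          Complex.exp (((-2 * Real.pi * x * (p / (2 * Real.pi)) : ℝ) : ℂ) * Complex.I) := by
      rw [← Complex.exp_conj, ← Complex.exp_conj, ← Complex.exp_add, ← Complex.exp_add]
      congr 1
      have : (-2 * Real.pi * x * (p / (2 * Real.pi)) : ℝ) = - x * p := by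
        field_simp
      rw [this]
      simp only [map_mul, map_div₀, map_sub, Complex.conj_I, Complex.conj_ofReal, map_ofNat]
      push_cast
      ring
    simp only [weylOp, map_mul, smul_eq_mul]
    rw [hexp]
    ring
  simp_rw [hx]
  rw [integral_const_mul, Real.fourier_real_eq_integral_exp_smul, enorm_mul]
  have h1 : ‖Complex.exp ((q * p / 2 : ℝ) * Complex.I)‖ₑ = 1 := by
    rw [← ofReal_norm, Complex.norm_exp_ofReal_mul_I, ENNReal.ofReal_one]
  rw [h1, one_mul]

/-- Square integrability of the Weyl representation of the plane. -/
lemma lintegral_enorm_integral_conj_weylOp_mul_sq {ψ φ : ℝ → ℂ} (hψ : StronglyMeasurable ψ)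
    (hφ : StronglyMeasurable φ) (hψ2 : MemLp ψ 2) (hφ2 : MemLp φ 2) :
    ∫⁻ q : ℝ, ∫⁻ p : ℝ, ‖∫ x, φ x * (starRingEnd ℂ) (weylOp q p ψ x)‖ₑ ^ 2 =
      ENNReal.ofReal (2 * Real.pi) * ((∫⁻ x, ‖ψ x‖ₑ ^ 2) * ∫⁻ x, ‖φ x‖ₑ ^ 2) := by
  simp_rw [enorm_integral_conj_weylOp_mul]
  have hmeas : Measurable (Function.uncurry fun q x : ℝ =>
      ‖φ x * (starRingEnd ℂ) (ψ (x - q))‖ₑ ^ 2) := by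
    have h1 := hφ.measurable
    have h2 := hψ.measurable
    simp only [Function.uncurry_def, enorm_mul, RCLike.enorm_conj]
    fun_prop
  have htot : ∫⁻ q : ℝ, ∫⁻ x : ℝ, ‖φ x * (starRingEnd ℂ) (ψ (x - q))‖ₑ ^ 2 =
      (∫⁻ x, ‖ψ x‖ₑ ^ 2) * ∫⁻ x, ‖φ x‖ₑ ^ 2 := by
    rw [lintegral_lintegral_swap hmeas.aemeasurable]
    have h2 := hφ.measurable
    rw [← lintegral_const_mul _ (by fun_prop)]
    refine lintegral_congr fun x => ?_
    simp_rw [enorm_mul, mul_pow, RCLike.enorm_conj]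
    have h1 := hψ.measurable
    rw [lintegral_const_mul _ (by fun_prop),
      lintegral_sub_left_eq_self (fun y => ‖ψ y‖ₑ ^ 2) x, mul_comm]
  have hfin : (∫⁻ x, ‖ψ x‖ₑ ^ 2) * ∫⁻ x, ‖φ x‖ₑ ^ 2 ≠ ⊤ := by
    rw [← eLpNorm_two_sq, ← eLpNorm_two_sq]
    exact ENNReal.mul_ne_top (ENNReal.pow_ne_top hψ2.2.ne) (ENNReal.pow_ne_top hφ2.2.ne)
  have hae : ∀ᵐ q : ℝ, ∫⁻ x : ℝ, ‖φ x * (starRingEnd ℂ) (ψ (x - q))‖ₑ ^ 2 < ⊤ :=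
    ae_lt_top hmeas.lintegral_prod_right' (by rw [← htot] at hfin; exact hfin)
  have hq : ∀ᵐ q : ℝ, ∫⁻ p : ℝ,
      ‖𝓕 (fun x => φ x * (starRingEnd ℂ) (ψ (x - q))) (p / (2 * Real.pi))‖ₑ ^ 2 =
        ENNReal.ofReal (2 * Real.pi) * ∫⁻ x : ℝ, ‖φ x * (starRingEnd ℂ) (ψ (x - q))‖ₑ ^ 2 := by
    filter_upwards [hae] with q hq
    have hψq : MemLp (fun x => (starRingEnd ℂ) (ψ (x - q))) 2 :=
      (hψ2.comp_measurePreserving (measurePreserving_sub_right volume q)).star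
    have hintg : Integrable (fun x => φ x * (starRingEnd ℂ) (ψ (x - q))) :=
      hφ2.integrable_mul hψq
    have hmem : MemLp (fun x => φ x * (starRingEnd ℂ) (ψ (x - q))) 2 := by
      refine ⟨hintg.1, ?_⟩
      rw [← eLpNorm_two_sq] at hq
      exact (ENNReal.pow_lt_top_iff.1 hq).resolve_right two_ne_zero
    rw [lintegral_comp_div (fun w => ‖𝓕 (fun x => φ x * (starRingEnd ℂ) (ψ (x - q))) w‖ₑ ^ 2)
      Real.two_pi_pos, lintegral_enorm_fourier_sq hintg hmem]
  rw [lintegral_congr_ae hq, lintegral_const_mul' _ _ ENNReal.ofReal_ne_top, htot]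

section POVM

variable {α H K : Type*} [MeasurableSpace α] [NormedAddCommGroup H] [InnerProductSpace ℂ H]
  [NormedAddCommGroup K] [InnerProductSpace ℂ K]

/-- A family of operators `G z` with `∫ ‖G z φ‖² dμ(z) = ‖φ‖²` defines an isometry
`φ ↦ (z ↦ G z φ)` into `L²(μ; K)`. -/
lemma exists_isometry_toLp {μ : Measure α} (G : α → H →L[ℂ] K)
    (hmeas : ∀ φ, AEStronglyMeasurable (fun z => G z φ) μ)
    (hnorm : ∀ φ, ∫⁻ z, ‖G z φ‖ₑ ^ 2 ∂μ = ‖φ‖ₑ ^ 2) :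
    ∃ T : H →ₗᵢ[ℂ] Lp K 2 μ, ∀ φ, T φ =ᵐ[μ] fun z => G z φ := by
  have heLp : ∀ φ, eLpNorm (fun z => G z φ) 2 μ = ‖φ‖ₑ := fun φ =>
    (ENNReal.pow_right_strictMono two_ne_zero).injective
      ((eLpNorm_two_sq μ _).trans (hnorm φ))
  have hmem : ∀ φ, MemLp (fun z => G z φ) 2 μ := fun φ =>
    ⟨hmeas φ, by rw [heLp]; exact enorm_lt_top⟩
  refine ⟨{ toFun := fun φ => (hmem φ).toLp _
            map_add' := fun φ ψ => ?_
            map_smul' := fun c φ => ?_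
            norm_map' := fun φ => ?_ }, fun φ => (hmem φ).coeFn_toLp⟩
  · rw [← MemLp.toLp_add]
    exact MemLp.toLp_congr _ _ (ae_of_all _ fun z => by simp)
  · rw [← MemLp.toLp_const_smul]
    exact MemLp.toLp_congr _ _ (ae_of_all _ fun z => by simp)
  · simp [Lp.norm_toLp, heLp]

/-- A family of operators `G z` with `∫ ‖G z φ‖² dμ(z) = ‖φ‖²` defines a normalized
positive-operator-valued measure with density `(G z)* G z` with respect to `μ`. -/
theorem exists_povm_of_lintegral_enorm_sq [CompleteSpace H] [CompleteSpace K]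
    {μ : Measure α} (G : α → H →L[ℂ] K)
    (hmeas : ∀ φ, AEStronglyMeasurable (fun z => G z φ) μ)
    (hnorm : ∀ φ, ∫⁻ z, ‖G z φ‖ₑ ^ 2 ∂μ = ‖φ‖ₑ ^ 2) :
    ∃ E : Set α → H →L[ℂ] H, (∀ Z, (E Z).IsPositive) ∧ E Set.univ = 1 ∧
      (∀ Z φ ψ, ⟪φ, E Z ψ⟫ = ∫ z in Z, ⟪G z φ, G z ψ⟫ ∂μ) ∧
      ∀ f : ℕ → Set α, (∀ n, MeasurableSet (f n)) → Pairwise (Function.onFun Disjoint f) →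
        ∀ φ ψ : H, HasSum (fun n => ⟪φ, E (f n) ψ⟫) ⟪φ, E (⋃ n, f n) ψ⟫ := by
  obtain ⟨T, hT⟩ := exists_isometry_toLp G hmeas hnorm
  let V : (Z : Set α) → H →L[ℂ] Lp K 2 (μ.restrict Z) := fun Z =>
    LpToLpRestrictCLM α K ℂ μ 2 Z ∘L T.toContinuousLinearMap
  have hV : ∀ Z φ, V Z φ =ᵐ[μ.restrict Z] fun z => G z φ := fun Z φ =>
    (LpToLpRestrictCLM_coeFn ℂ Z (T φ)).trans (ae_restrict_of_ae (hT φ))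
  have hE : ∀ Z φ ψ, ⟪φ, (ContinuousLinearMap.adjoint (V Z) ∘L V Z) ψ⟫ =
      ∫ z in Z, ⟪G z φ, G z ψ⟫ ∂μ := by
    intro Z φ ψ
    rw [ContinuousLinearMap.comp_apply, ContinuousLinearMap.adjoint_inner_right, L2.inner_def]
    refine integral_congr_ae ?_
    filter_upwards [hV Z φ, hV Z ψ] with z h1 h2
    rw [h1, h2]
  have hTi : ∀ φ ψ, (fun z => ⟪T φ z, T ψ z⟫) =ᵐ[μ] fun z => ⟪G z φ, G z ψ⟫ := by
    intro φ ψ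
    filter_upwards [hT φ, hT ψ] with z h1 h2
    rw [h1, h2]
  have hintg : ∀ φ ψ, Integrable (fun z => ⟪G z φ, G z ψ⟫) μ := fun φ ψ =>
    (L2.integrable_inner (𝕜 := ℂ) (T φ) (T ψ)).congr (hTi φ ψ)
  refine ⟨fun Z => ContinuousLinearMap.adjoint (V Z) ∘L V Z,
    fun Z => ContinuousLinearMap.isPositive_adjoint_comp_self _, ?_, hE, ?_⟩
  · ext1 ψ
    refine ext_inner_left ℂ fun φ => ?_
    rw [hE, Measure.restrict_univ, ← integral_congr_ae (hTi φ ψ), ← L2.inner_def,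
      T.inner_map_map, one_apply_eq_self]
  · intro f hf hd φ ψ
    simp only [hE]
    exact hasSum_integral_iUnion hf hd (hintg φ ψ).integrableOn

end POVM

section HilbertBasis

variable {ι H : Type*} [NormedAddCommGroup H] [InnerProductSpace ℂ H]

/-- A weakly measurable function into a separable Hilbert space is strongly measurable. -/
lemma HilbertBasis.stronglyMeasurable_of_inner {α : Type*} [MeasurableSpace α] [Countable ι]
    (e : HilbertBasis ι ℂ H) {f : α → H} (hf : ∀ i, StronglyMeasurable fun z => ⟪e i, f z⟫) :
    StronglyMeasurable f := by
  refine stronglyMeasurable_of_tendsto (Filter.atTop : Filter (Finset ι))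
    (f := fun s z => ∑ i ∈ s, ⟪e i, f z⟫ • e i)
    (fun s => Finset.stronglyMeasurable_fun_sum _ fun i _ => (hf i).smul_const _) ?_
  rw [tendsto_pi_nhds]
  intro z
  simpa only [e.repr_apply_apply] using! e.hasSum_repr (f z)

lemma HilbertBasis.tsum_enorm_inner_sq (e : HilbertBasis ι ℂ H) (x : H) :
    ∑' i, ‖⟪e i, x⟫‖ₑ ^ 2 = ‖x‖ₑ ^ 2 := by
  have h : HasSum (fun i => ‖⟪e i, x⟫‖ ^ 2) (‖x‖ ^ 2) := by
    have h1 := (e.hasSum_inner_mul_inner x x).mapL Complex.reCLM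
    convert h1 using 1
    · ext i
      rw [Complex.reCLM_apply, ← inner_conj_symm x (e i), ← Complex.normSq_eq_conj_mul_self,
        Complex.ofReal_re, Complex.normSq_eq_norm_sq]
    · exact (inner_self_eq_norm_sq (𝕜 := ℂ) x).symm
  simp_rw [← ofReal_norm, ← ENNReal.ofReal_pow (norm_nonneg _)]
  rw [← ENNReal.ofReal_tsum_of_nonneg (fun _ => by positivity) h.summable, h.tsum_eq]

/-- For `R = √S` and an orthonormal basis `e`, the sum of `‖R (e n)‖²` is the trace of `S`. -/
lemma tsum_enorm_sq_eq_of_comp_self_eq [CompleteSpace H] {R S : H →L[ℂ] H}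
    (hR : IsSelfAdjoint R) (hRS : R * R = S)
    (e : ι → H) {c : ℝ} (hS : HasSum (fun i => ⟪e i, S (e i)⟫) (c : ℂ)) :
    ∑' i, ‖R (e i)‖ₑ ^ 2 = ENNReal.ofReal c := by
  have h : HasSum (fun i => ‖R (e i)‖ ^ 2) c := by
    convert! hS.mapL Complex.reCLM using 2 with i
    rw [← hRS, mul_apply_eq_comp, ← ContinuousLinearMap.adjoint_inner_left,
      hR.adjoint_eq, Complex.reCLM_apply]
    exact (inner_self_eq_norm_sq (𝕜 := ℂ) (R (e i))).symm
  simp_rw [← ofReal_norm, ← ENNReal.ofReal_pow (norm_nonneg _)]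
  rw [← ENNReal.ofReal_tsum_of_nonneg (fun _ => by positivity) h.summable, h.tsum_eq]

lemma ContinuousLinearMap.IsPositive.exists_isSelfAdjoint_mul_self_eq [CompleteSpace H]
    {S : H →L[ℂ] H} (hS : S.IsPositive) : ∃ R : H →L[ℂ] H, IsSelfAdjoint R ∧ R * R = S :=
  have hS' : 0 ≤ S := (ContinuousLinearMap.nonneg_iff_isPositive S).2 hS
  ⟨CFC.sqrt S, (CFC.sqrt_nonneg S).isSelfAdjoint, CFC.sqrt_mul_sqrt_self S hS'⟩

end HilbertBasis

section Weyl

variable {W : ℝ → ℝ → (Lp ℂ 2 (volume : Measure ℝ) →L[ℂ] Lp ℂ 2 (volume : Measure ℝ))}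

lemma stronglyMeasurable_integral_conj_weylOp_mul {ψ φ : ℝ → ℂ} (hψ : StronglyMeasurable ψ)
    (hφ : StronglyMeasurable φ) :
    StronglyMeasurable fun z : ℝ × ℝ =>
      ∫ x, φ x * (starRingEnd ℂ) (weylOp z.1 z.2 ψ x) := by
  refine StronglyMeasurable.integral_prod_right
    (f := fun (z : ℝ × ℝ) x => φ x * (starRingEnd ℂ) (weylOp z.1 z.2 ψ x)) ?_
  simp only [Function.uncurry_def, weylOp]
  have h1 : StronglyMeasurable fun y : (ℝ × ℝ) × ℝ => ψ (y.2 - y.1.1) :=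
    hψ.comp_measurable (by fun_prop)
  have h2 : StronglyMeasurable fun y : (ℝ × ℝ) × ℝ => φ y.2 := hφ.comp_measurable measurable_snd
  have h3 : Continuous fun y : (ℝ × ℝ) × ℝ => Complex.exp (Complex.I * y.1.1 * y.1.2 / 2) *
      Complex.exp (Complex.I * y.1.2 * (y.2 - y.1.1)) := by fun_prop
  exact h2.mul (Complex.continuous_conj.comp_stronglyMeasurable (h3.stronglyMeasurable.mul h1))

lemma inner_weyl_eq_integral
    (hW : ∀ (q p : ℝ) (f : Lp ℂ 2 (volume : Measure ℝ)),
      (W q p f : ℝ → ℂ) =ᵐ[volume] weylOp q p f)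
    (q p : ℝ) (ψ φ : Lp ℂ 2 (volume : Measure ℝ)) :
    ⟪W q p ψ, φ⟫ = ∫ x, φ x * (starRingEnd ℂ) (weylOp q p ψ x) := by
  rw [L2.inner_def]
  refine integral_congr_ae ?_
  filter_upwards [hW q p ψ] with x hx
  rw [hx, RCLike.inner_apply]

lemma stronglyMeasurable_inner_weyl
    (hW : ∀ (q p : ℝ) (f : Lp ℂ 2 (volume : Measure ℝ)),
      (W q p f : ℝ → ℂ) =ᵐ[volume] weylOp q p f)
    (ψ φ : Lp ℂ 2 (volume : Measure ℝ)) :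
    StronglyMeasurable fun z : ℝ × ℝ => ⟪W z.1 z.2 ψ, φ⟫ := by
  simp_rw [inner_weyl_eq_integral hW]
  exact stronglyMeasurable_integral_conj_weylOp_mul (Lp.stronglyMeasurable ψ)
    (Lp.stronglyMeasurable φ)

/-- The orthogonality relations for the matrix coefficients of the Weyl operators. -/
lemma lintegral_enorm_inner_weyl_sq
    (hW : ∀ (q p : ℝ) (f : Lp ℂ 2 (volume : Measure ℝ)),
      (W q p f : ℝ → ℂ) =ᵐ[volume] weylOp q p f)
    (ψ φ : Lp ℂ 2 (volume : Measure ℝ)) :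
    ∫⁻ z : ℝ × ℝ, ‖⟪W z.1 z.2 ψ, φ⟫‖ₑ ^ 2 =
      ENNReal.ofReal (2 * Real.pi) * (‖ψ‖ₑ ^ 2 * ‖φ‖ₑ ^ 2) := by
  rw [Measure.volume_eq_prod, lintegral_prod _
    (((stronglyMeasurable_inner_weyl hW ψ φ).enorm.pow_const 2).aemeasurable)]
  simp_rw [inner_weyl_eq_integral hW]
  rw [lintegral_enorm_integral_conj_weylOp_mul_sq (Lp.stronglyMeasurable ψ)
    (Lp.stronglyMeasurable φ) (Lp.memLp ψ) (Lp.memLp φ), Lp.enorm_def, Lp.enorm_def,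
    eLpNorm_two_sq, eLpNorm_two_sq]

lemma stronglyMeasurable_apply_adjoint_weyl
    (hW : ∀ (q p : ℝ) (f : Lp ℂ 2 (volume : Measure ℝ)),
      (W q p f : ℝ → ℂ) =ᵐ[volume] weylOp q p f)
    {ι : Type*} [Countable ι] (e : HilbertBasis ι ℂ (Lp ℂ 2 (volume : Measure ℝ)))
    (R : Lp ℂ 2 (volume : Measure ℝ) →L[ℂ] Lp ℂ 2 (volume : Measure ℝ))
    (φ : Lp ℂ 2 (volume : Measure ℝ)) :
    StronglyMeasurable fun z : ℝ × ℝ => R (ContinuousLinearMap.adjoint (W z.1 z.2) φ) := by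
  refine e.stronglyMeasurable_of_inner fun i => ?_
  simp_rw [← ContinuousLinearMap.adjoint_inner_left R, ContinuousLinearMap.adjoint_inner_right]
  exact stronglyMeasurable_inner_weyl hW _ _

lemma lintegral_enorm_apply_adjoint_weyl_sq
    (hW : ∀ (q p : ℝ) (f : Lp ℂ 2 (volume : Measure ℝ)),
      (W q p f : ℝ → ℂ) =ᵐ[volume] weylOp q p f)
    {ι : Type*} [Countable ι] (e : HilbertBasis ι ℂ (Lp ℂ 2 (volume : Measure ℝ)))
    (R : Lp ℂ 2 (volume : Measure ℝ) →L[ℂ] Lp ℂ 2 (volume : Measure ℝ))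
    (φ : Lp ℂ 2 (volume : Measure ℝ)) :
    ∫⁻ z : ℝ × ℝ, ‖R (ContinuousLinearMap.adjoint (W z.1 z.2) φ)‖ₑ ^ 2 =
      ENNReal.ofReal (2 * Real.pi) *
        ((∑' i, ‖ContinuousLinearMap.adjoint R (e i)‖ₑ ^ 2) * ‖φ‖ₑ ^ 2) := by
  simp_rw [← e.tsum_enorm_inner_sq (R _), ← ContinuousLinearMap.adjoint_inner_left R,
    ContinuousLinearMap.adjoint_inner_right]
  rw [lintegral_tsum fun i =>
    ((stronglyMeasurable_inner_weyl hW _ _).enorm.pow_const 2).aemeasurable]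
  simp_rw [lintegral_enorm_inner_weyl_sq hW]
  rw [ENNReal.tsum_mul_left, ENNReal.tsum_mul_right]

end Weyl

/-- For any positive trace-one operator `S` on `L²(ℝ)`, the weak integrals
`⟨φ, E^S(Z)φ⟩ = (1/2π)∫_Z ⟨W(q,p)*φ, S W(q,p)*φ⟩ dq dp` define a normalized
positive-operator-valued measure `E^S` on the Borel sets of `ℝ²`. Here `W` is the family
of Weyl operators, given as bounded operators acting by the formula `weylOp`. -/
theorem phaseSpaceObservable_exists
    (W : ℝ → ℝ → (Lp ℂ 2 (volume : Measure ℝ) →L[ℂ] Lp ℂ 2 (volume : Measure ℝ)))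
    (hW : ∀ (q p : ℝ) (f : Lp ℂ 2 (volume : Measure ℝ)),
      (W q p f : ℝ → ℂ) =ᵐ[volume] weylOp q p f)
    (S : Lp ℂ 2 (volume : Measure ℝ) →L[ℂ] Lp ℂ 2 (volume : Measure ℝ))
    (hSpos : S.IsPositive)
    (e : HilbertBasis ℕ ℂ (Lp ℂ 2 (volume : Measure ℝ)))
    (htr : (∑' n : ℕ, ⟪e n, S (e n)⟫) = 1) :
    ∃ E : Set (ℝ × ℝ) → (Lp ℂ 2 (volume : Measure ℝ) →L[ℂ] Lp ℂ 2 (volume : Measure ℝ)),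
      (∀ Z : Set (ℝ × ℝ), MeasurableSet Z → (E Z).IsPositive) ∧
      E Set.univ = 1 ∧
      (∀ Z : Set (ℝ × ℝ), MeasurableSet Z → ∀ φ : Lp ℂ 2 (volume : Measure ℝ),
        ⟪φ, E Z φ⟫ = (1 / (2 * Real.pi) : ℝ) *
          ∫ z in Z, ⟪(ContinuousLinearMap.adjoint (W z.1 z.2)) φ,
            S ((ContinuousLinearMap.adjoint (W z.1 z.2)) φ)⟫) ∧
      (∀ f : ℕ → Set (ℝ × ℝ), (∀ n, MeasurableSet (f n)) →
        Pairwise (Function.onFun Disjoint f) →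
        ∀ φ ψ : Lp ℂ 2 (volume : Measure ℝ),
          HasSum (fun n => ⟪φ, E (f n) ψ⟫) ⟪φ, E (⋃ n, f n) ψ⟫) := by
  obtain ⟨R, hR, hRS⟩ := hSpos.exists_isSelfAdjoint_mul_self_eq
  have hsum : HasSum (fun n => ⟪e n, S (e n)⟫) ((1 : ℝ) : ℂ) := by
    have hs : Summable fun n => ⟪e n, S (e n)⟫ := by
      by_contra h
      rw [tsum_eq_zero_of_not_summable h] at htr
      exact zero_ne_one htr
    rw [Complex.ofReal_one, ← htr]
    exact hs.hasSum
  set c : ℝ := (√(2 * Real.pi))⁻¹ with hc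
  have hc2 : c * c = 1 / (2 * Real.pi) := by
    rw [hc, ← mul_inv, Real.mul_self_sqrt Real.two_pi_pos.le, one_div]
  let G : ℝ × ℝ → Lp ℂ 2 (volume : Measure ℝ) →L[ℂ] Lp ℂ 2 (volume : Measure ℝ) := fun z =>
    (c : ℂ) • (R ∘L ContinuousLinearMap.adjoint (W z.1 z.2))
  have hGm : ∀ φ, AEStronglyMeasurable (fun z => G z φ) volume := fun φ =>
    ((stronglyMeasurable_apply_adjoint_weyl hW e R φ).const_smul (c : ℂ)).aestronglyMeasurable
  have hcn : ‖(c : ℂ)‖ₑ ^ 2 * ENNReal.ofReal (2 * Real.pi) = 1 := by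
    rw [← ofReal_norm, ← ENNReal.ofReal_pow (norm_nonneg _), ← ENNReal.ofReal_mul (by positivity),
      Complex.norm_real, Real.norm_eq_abs, sq_abs, sq, hc2, one_div,
      inv_mul_cancel₀ Real.two_pi_pos.ne', ENNReal.ofReal_one]
  have hGn : ∀ φ, ∫⁻ z, ‖G z φ‖ₑ ^ 2 = ‖φ‖ₑ ^ 2 := by
    intro φ
    have h : ∀ z, ‖G z φ‖ₑ ^ 2 =
        ‖(c : ℂ)‖ₑ ^ 2 * ‖R (ContinuousLinearMap.adjoint (W z.1 z.2) φ)‖ₑ ^ 2 := fun z => by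
      simp only [G, smul_apply, ContinuousLinearMap.comp_apply, enorm_smul, mul_pow]
    simp_rw [h]
    rw [lintegral_const_mul' _ _ (by finiteness), lintegral_enorm_apply_adjoint_weyl_sq hW e R φ,
      hR.adjoint_eq, tsum_enorm_sq_eq_of_comp_self_eq hR hRS e hsum, ENNReal.ofReal_one, one_mul,
      ← mul_assoc, hcn, one_mul]
  obtain ⟨E, hpos, huniv, hE, hadd⟩ := exists_povm_of_lintegral_enorm_sq G hGm hGn
  refine ⟨E, fun Z _ => hpos Z, huniv, fun Z _ φ => ?_, hadd⟩
  rw [hE, ← integral_const_mul]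
  congr 1 with z
  rw [← hRS, mul_apply_eq_comp, ← ContinuousLinearMap.adjoint_inner_left R, hR.adjoint_eq]
  simp only [G, smul_apply, ContinuousLinearMap.comp_apply, inner_smul_left,
    inner_smul_right, Complex.conj_ofReal]
  rw [← mul_assoc, ← Complex.ofReal_mul, hc2]
end

section
/- For any positive trace-one operators T, S on a Hilbert space H and any Borel set Z ⊆ ℝ²: Tr[T E^S(Z)] = Tr[S E^T(−Z)], where −Z = {−z : z ∈ Z}. -/
open MeasureTheory
open scoped ComplexInnerProductSpace Pointwise


section HilbertSpace

variable {H : Type*} [NormedAddCommGroup H] [InnerProductSpace ℂ H]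

theorem HilbertBasis.hasSum_sq_norm_inner {ι : Type*} (e : HilbertBasis ι ℂ H) (x : H) :
    HasSum (fun n => ‖⟪e n, x⟫‖ ^ 2) (‖x‖ ^ 2) := by
  have h := e.hasSum_inner_mul_inner x x
  rw [inner_self_eq_norm_sq_to_K] at h
  have h' := Complex.hasSum_re h
  convert h' using 1
  · ext n
    rw [← inner_conj_symm x (e n), mul_comm, Complex.mul_conj, Complex.normSq_eq_norm_sq,
      Complex.ofReal_re]
  · norm_cast

theorem HilbertBasis.tsum_sq_enorm_inner {ι : Type*} (e : HilbertBasis ι ℂ H) (x : H) :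
    ∑' n, ‖⟪e n, x⟫‖ₑ ^ 2 = ‖x‖ₑ ^ 2 := by
  have h := e.hasSum_sq_norm_inner x
  have key := ENNReal.ofReal_tsum_of_nonneg (fun n => by positivity) h.summable
  rw [h.tsum_eq] at key
  simpa [ENNReal.ofReal_pow] using key.symm

/-- For norm-square-summable families `u`, `v`, the double series of the products of their
coordinates converges absolutely. -/
theorem HilbertBasis.summable_uncurry_inner_mul_inner {ι : Type*} (e : HilbertBasis ι ℂ H)
    {u v : ι → H} (hu : Summable fun m => ‖u m‖ ^ 2) (hv : Summable fun m => ‖v m‖ ^ 2) :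
    Summable (Function.uncurry fun m n => ⟪v m, e n⟫ * ⟪e n, u m⟫) := by
  have aux : ∀ w : ι → H, (Summable fun m => ‖w m‖ ^ 2) →
      Summable fun p : ι × ι => ‖⟪e p.2, w p.1⟫‖ ^ 2 := by
    intro w hw
    refine (summable_prod_of_nonneg (fun p => by positivity)).2
      ⟨fun m => (e.hasSum_sq_norm_inner (w m)).summable, ?_⟩
    simpa only [(e.hasSum_sq_norm_inner _).tsum_eq] using hw
  refine Summable.of_norm_bounded ((aux u hu).add (aux v hv)) ?_
  rintro ⟨m, n⟩
  simp only [Function.uncurry, norm_mul]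
  rw [norm_inner_symm]
  nlinarith [sq_nonneg (‖⟪e n, v m⟫‖ - ‖⟪e n, u m⟫‖), sq_nonneg ‖⟪e n, v m⟫‖,
    sq_nonneg ‖⟪e n, u m⟫‖]

/-- Cyclicity of the trace for `R R E`, with `R` self-adjoint Hilbert–Schmidt and `E` bounded
symmetric. -/
theorem HilbertBasis.tsum_inner_cyclic {ι : Type*} (e : HilbertBasis ι ℂ H) {R E : H →L[ℂ] H}
    (hR : (R : H →ₗ[ℂ] H).IsSymmetric) (hE : (E : H →ₗ[ℂ] H).IsSymmetric)
    (hsum : Summable fun n => ‖R (e n)‖ ^ 2) :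
    ∑' n, ⟪e n, R (R (E (e n)))⟫ = ∑' n, ⟪R (e n), E (R (e n))⟫ := by
  have hsum' : Summable fun n => ‖E (R (e n))‖ ^ 2 := by
    refine Summable.of_nonneg_of_le (fun n => by positivity) (fun n => ?_)
      (hsum.mul_left (‖E‖ ^ 2))
    rw [← mul_pow]
    gcongr
    exact E.le_opNorm _
  have hR' : ∀ x y, ⟪R x, y⟫ = ⟪x, R y⟫ := hR
  have hE' : ∀ x y, ⟪E x, y⟫ = ⟪x, E y⟫ := hE
  have hcomm := (e.summable_uncurry_inner_mul_inner hsum hsum').tsum_comm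
  calc ∑' n, ⟪e n, R (R (E (e n)))⟫
      = ∑' n, ∑' m, ⟪E (R (e m)), e n⟫ * ⟪e n, R (e m)⟫ := by
        refine tsum_congr fun n => ?_
        rw [← hR', ← e.tsum_inner_mul_inner]
        refine tsum_congr fun m => ?_
        rw [hR', ← hR' (e m), ← hE', mul_comm]
    _ = ∑' m, ∑' n, ⟪E (R (e m)), e n⟫ * ⟪e n, R (e m)⟫ := hcomm
    _ = ∑' m, ⟪R (e m), E (R (e m))⟫ := by
        refine tsum_congr fun m => ?_
        rw [e.tsum_inner_mul_inner, hE']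

/-- If the quadratic form of a bounded operator is a multiple of `ENNReal.toReal` of an extended-valued
quadratic form that takes the value `∞`, the operator vanishes. -/
theorem ContinuousLinearMap.eq_zero_of_inner_eq_toReal {E : H →L[ℂ] H} {G : H → ENNReal} {c : ℝ}
    (hadd : ∀ x y, G (x + y) ≤ 2 * (G x + G y)) (hneg : ∀ x, G (-x) = G x)
    (hE : ∀ x, ⟪x, E x⟫ = (c : ℂ) * ((G x).toReal : ℂ)) {x : H} (hx : G x = ⊤) : E = 0 := by
  have h0 : ∀ z, G z = ⊤ → ⟪z, E z⟫ = 0 := fun z hz => by simp [hE, hz]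
  have hform : ∀ y, ⟪y, E y⟫ = 0 := by
    intro y
    by_cases hy : G y = ⊤
    · exact h0 y hy
    have hxy : ∀ z, x = z + y ∨ x = z + -y → G z = ⊤ := by
      intro z hz
      by_contra hzt
      have hlt : 2 * (G z + G y) < ⊤ :=
        ENNReal.mul_lt_top (by simp) (ENNReal.add_lt_top.2 ⟨Ne.lt_top hzt, Ne.lt_top hy⟩)
      rcases hz with rfl | rfl
      · exact (hx ▸ hadd z y).not_gt hlt
      · have := hadd z (-y)
        rw [hneg, hx] at this
        exact this.not_gt hlt
    have hp := h0 (x + y) (hxy _ (Or.inr (by abel)))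
    have hm := h0 (x - y) (hxy _ (Or.inl (by abel)))
    have hx0 := h0 x hx
    simp only [map_add, map_sub, inner_add_left, inner_add_right, inner_sub_left,
      inner_sub_right] at hp hm
    linear_combination (hp + hm) / 2 - hx0
  have := (inner_map_self_eq_zero (E : H →ₗ[ℂ] H)).1 fun y => by
    rw [← inner_conj_symm]
    simp [hform y]
  exact ContinuousLinearMap.coe_injective this

theorem HilbertBasis.tsum_inner_eq_toReal {ι : Type*} (e : HilbertBasis ι ℂ H)
    {R E : H →L[ℂ] H} (hR : (R : H →ₗ[ℂ] H).IsSymmetric)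
    (hsum : Summable fun n => ‖R (e n)‖ ^ 2) {G : H → ENNReal} {c : ℝ}
    (hadd : ∀ x y, G (x + y) ≤ 2 * (G x + G y)) (hneg : ∀ x, G (-x) = G x)
    (hE : ∀ x, ⟪x, E x⟫ = (c : ℂ) * ((G x).toReal : ℂ)) :
    ∑' n, ⟪e n, R (R (E (e n)))⟫ = (c : ℂ) * ((∑' n, G (R (e n))).toReal : ℂ) := by
  by_cases hfin : ∀ n, G (R (e n)) ≠ ⊤
  · have hEs : (E : H →ₗ[ℂ] H).IsSymmetric := by
      rw [LinearMap.isSymmetric_iff_inner_map_self_real]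
      intro x
      have hx : ⟪E x, x⟫ = (c : ℂ) * ((G x).toReal : ℂ) := by
        rw [← inner_conj_symm, hE]
        simp
      simp [hx]
    rw [e.tsum_inner_cyclic hR hEs hsum, ENNReal.tsum_toReal_eq hfin, Complex.ofReal_tsum,
      ← tsum_mul_left]
    exact tsum_congr fun n => hE _
  · push Not at hfin
    obtain ⟨n, hn⟩ := hfin
    rw [ContinuousLinearMap.eq_zero_of_inner_eq_toReal hadd hneg hE hn,
      ENNReal.tsum_eq_top_of_eq_top ⟨n, hn⟩]
    simp

theorem ContinuousLinearMap.IsPositive.exists_symmetric_sqrt [CompleteSpace H] {S : H →L[ℂ] H}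
    (hS : S.IsPositive) :
    ∃ R : H →L[ℂ] H, (R : H →ₗ[ℂ] H).IsSymmetric ∧ ∀ x, R (R x) = S x := by
  have h := CFC.sqrt_mul_sqrt_self S ((ContinuousLinearMap.nonneg_iff_isPositive S).2 hS)
  exact ⟨CFC.sqrt S,
    ContinuousLinearMap.isSelfAdjoint_iff_isSymmetric.1 (CFC.sqrt_nonneg S).isSelfAdjoint,
    fun x => congrArg (fun A : H →L[ℂ] H => A x) h⟩

theorem summable_sq_norm_of_tsum_inner_ne_zero {ι : Type*} {e : ι → H} {R S : H →L[ℂ] H}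
    (hR : (R : H →ₗ[ℂ] H).IsSymmetric) (hRS : ∀ x, R (R x) = S x)
    (h : ∑' n, ⟪e n, S (e n)⟫ ≠ 0) : Summable fun n => ‖R (e n)‖ ^ 2 := by
  have hs : Summable fun n => ⟪e n, S (e n)⟫ := by
    by_contra hns
    exact h (tsum_eq_zero_of_not_summable hns)
  have hR' : ∀ x y, ⟪R x, y⟫ = ⟪x, R y⟫ := hR
  refine (Complex.hasSum_re hs.hasSum).summable.congr fun n => ?_
  rw [← hRS, ← hR', inner_self_eq_norm_sq_to_K]
  norm_cast

end HilbertSpace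

section WeylOperators

variable {W : ℝ → ℝ → (Lp ℂ 2 (volume : Measure ℝ) →L[ℂ] Lp ℂ 2 (volume : Measure ℝ))}

theorem adjoint_weyl
    (hW : ∀ (q p : ℝ) (f : Lp ℂ 2 (volume : Measure ℝ)),
      (W q p f : ℝ → ℂ) =ᵐ[volume] weylOp q p f) (q p : ℝ) :
    ContinuousLinearMap.adjoint (W q p) = W (-q) (-p) := by
  symm
  rw [ContinuousLinearMap.eq_adjoint_iff]
  intro u v
  rw [L2.inner_def, L2.inner_def,
    ← integral_sub_right_eq_self (fun x => ⟪(W (-q) (-p) u : ℝ → ℂ) x, (v : ℝ → ℂ) x⟫) q]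
  have hu := (measurePreserving_sub_right volume q).quasiMeasurePreserving.ae_eq
    (hW (-q) (-p) u)
  refine integral_congr_ae ?_
  filter_upwards [hu, hW q p v] with x hx hv
  simp only [Function.comp_apply] at hx
  rw [hx, hv]
  simp only [weylOp, RCLike.inner_apply, map_mul, ← Complex.exp_conj, map_div₀,
    Complex.conj_I, Complex.conj_ofReal, Complex.ofReal_neg, Complex.ofReal_sub, map_neg,
    Complex.conj_ofNat, sub_neg_eq_add, sub_add_cancel]
  have : Complex.exp (Complex.I * q * p / 2) * Complex.exp (Complex.I * p * (x - q))
      = Complex.exp (-Complex.I * -q * -p / 2) * Complex.exp (-Complex.I * -p * x) := by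
    rw [← Complex.exp_add, ← Complex.exp_add]
    congr 1
    ring
  linear_combination -(v : ℝ → ℂ) (x - q) * (starRingEnd ℂ) ((u : ℝ → ℂ) x) * this

theorem measurable_inner_weyl
    (hW : ∀ (q p : ℝ) (f : Lp ℂ 2 (volume : Measure ℝ)),
      (W q p f : ℝ → ℂ) =ᵐ[volume] weylOp q p f) (u v : Lp ℂ 2 (volume : Measure ℝ)) :
    Measurable fun z : ℝ × ℝ => ⟪u, W z.1 z.2 v⟫ := by
  have hu : Measurable (u : ℝ → ℂ) := (Lp.stronglyMeasurable u).measurable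
  have hv : Measurable (v : ℝ → ℂ) := (Lp.stronglyMeasurable v).measurable
  have hm : Measurable (Function.uncurry fun (z : ℝ × ℝ) (x : ℝ) =>
      ⟪(u : ℝ → ℂ) x, weylOp z.1 z.2 v x⟫) := by
    have : Measurable fun y : (ℝ × ℝ) × ℝ => (v : ℝ → ℂ) (y.2 - y.1.1) :=
      hv.comp (by fun_prop)
    have : Measurable fun y : (ℝ × ℝ) × ℝ => weylOp y.1.1 y.1.2 v y.2 := by
      unfold weylOp
      fun_prop
    have hu' : Measurable fun y : (ℝ × ℝ) × ℝ => (u : ℝ → ℂ) y.2 := hu.comp measurable_snd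
    exact hu'.inner this
  convert (hm.stronglyMeasurable.integral_prod_right (ν := volume)).measurable using 2 with z
  rw [L2.inner_def]
  refine integral_congr_ae ?_
  filter_upwards [hW z.1 z.2 v] with x hx
  rw [hx]

theorem measurable_sq_enorm_weyl
    (hW : ∀ (q p : ℝ) (f : Lp ℂ 2 (volume : Measure ℝ)),
      (W q p f : ℝ → ℂ) =ᵐ[volume] weylOp q p f)
    (e : HilbertBasis ℕ ℂ (Lp ℂ 2 (volume : Measure ℝ)))
    (A : Lp ℂ 2 (volume : Measure ℝ) →L[ℂ] Lp ℂ 2 (volume : Measure ℝ))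
    (φ : Lp ℂ 2 (volume : Measure ℝ)) :
    Measurable fun z : ℝ × ℝ => ‖A (W z.1 z.2 φ)‖ₑ ^ 2 := by
  have h : ∀ z : ℝ × ℝ, ‖A (W z.1 z.2 φ)‖ₑ ^ 2
      = ∑' n, ‖⟪ContinuousLinearMap.adjoint A (e n), W z.1 z.2 φ⟫‖ₑ ^ 2 := fun z => by
    simp only [ContinuousLinearMap.adjoint_inner_left, e.tsum_sq_enorm_inner]
  simp only [h]
  exact Measurable.tsum fun n =>
    (measurable_inner_weyl hW (ContinuousLinearMap.adjoint A (e n)) φ).enorm.pow_const 2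

/-- Exchanging the two symmetric factors amounts to the reflection `Z ↦ -Z`. -/
theorem tsum_lintegral_weyl_exchange
    (hW : ∀ (q p : ℝ) (f : Lp ℂ 2 (volume : Measure ℝ)),
      (W q p f : ℝ → ℂ) =ᵐ[volume] weylOp q p f)
    (e : HilbertBasis ℕ ℂ (Lp ℂ 2 (volume : Measure ℝ)))
    {Q R : Lp ℂ 2 (volume : Measure ℝ) →L[ℂ] Lp ℂ 2 (volume : Measure ℝ)}
    (hQ : (Q : Lp ℂ 2 (volume : Measure ℝ) →ₗ[ℂ] Lp ℂ 2 (volume : Measure ℝ)).IsSymmetric)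
    (hR : (R : Lp ℂ 2 (volume : Measure ℝ) →ₗ[ℂ] Lp ℂ 2 (volume : Measure ℝ)).IsSymmetric)
    {Z : Set (ℝ × ℝ)} (hZ : MeasurableSet Z) :
    ∑' m, ∫⁻ z in -Z, ‖Q (W z.1 z.2 (R (e m)))‖ₑ ^ 2
      = ∑' n, ∫⁻ z in Z, ‖R (W z.1 z.2 (Q (e n)))‖ₑ ^ 2 := by
  have hQ' : ∀ x y, ⟪Q x, y⟫ = ⟪x, Q y⟫ := hQ
  have hR' : ∀ x y, ⟪R x, y⟫ = ⟪x, R y⟫ := hR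
  have hmeas := measurable_sq_enorm_weyl hW e
  have hpt : ∀ z : ℝ × ℝ, ∑' m, ‖Q (W (-z).1 (-z).2 (R (e m)))‖ₑ ^ 2
      = ∑' n, ‖R (W z.1 z.2 (Q (e n)))‖ₑ ^ 2 := by
    intro z
    simp only [← e.tsum_sq_enorm_inner]
    rw [ENNReal.tsum_comm]
    refine tsum_congr fun n => tsum_congr fun m => ?_
    rw [Prod.fst_neg, Prod.snd_neg, ← adjoint_weyl hW, ← hQ',
      ContinuousLinearMap.adjoint_inner_right, ← hR', ← inner_conj_symm, RCLike.enorm_conj]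
  rw [← lintegral_tsum fun m => (hmeas Q _).aemeasurable,
    ← lintegral_tsum fun n => (hmeas R _).aemeasurable]
  simp only [← hpt]
  exact ((Measure.measurePreserving_neg (volume : Measure (ℝ × ℝ))).setLIntegral_comp_preimage
    hZ.neg (Measurable.tsum fun m => hmeas Q (R (e m)))).symm.trans
    (by rw [Set.neg_preimage, neg_neg])

/-- The trace of `T E^S(Z)`, with `T = R²` and `S = Q²`, as a series of Lebesgue integrals. -/
theorem tsum_inner_phaseSpace
    (hW : ∀ (q p : ℝ) (f : Lp ℂ 2 (volume : Measure ℝ)),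
      (W q p f : ℝ → ℂ) =ᵐ[volume] weylOp q p f)
    (e : HilbertBasis ℕ ℂ (Lp ℂ 2 (volume : Measure ℝ)))
    {S T E Q R : Lp ℂ 2 (volume : Measure ℝ) →L[ℂ] Lp ℂ 2 (volume : Measure ℝ)}
    (hQ : (Q : Lp ℂ 2 (volume : Measure ℝ) →ₗ[ℂ] Lp ℂ 2 (volume : Measure ℝ)).IsSymmetric)
    (hR : (R : Lp ℂ 2 (volume : Measure ℝ) →ₗ[ℂ] Lp ℂ 2 (volume : Measure ℝ)).IsSymmetric)
    (hQS : ∀ x, Q (Q x) = S x) (hRT : ∀ x, R (R x) = T x)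
    (hsum : Summable fun n => ‖R (e n)‖ ^ 2) {c : ℝ} {Z : Set (ℝ × ℝ)} (hZ : MeasurableSet Z)
    (hE : ∀ φ : Lp ℂ 2 (volume : Measure ℝ), ⟪φ, E φ⟫ = (c : ℂ) *
        ∫ z in Z, ⟪(ContinuousLinearMap.adjoint (W z.1 z.2)) φ,
          S ((ContinuousLinearMap.adjoint (W z.1 z.2)) φ)⟫) :
    ∑' n, ⟪e n, T (E (e n))⟫
      = (c : ℂ) * ((∑' n, ∫⁻ z in -Z, ‖Q (W z.1 z.2 (R (e n)))‖ₑ ^ 2).toReal : ℂ) := by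
  have hQ' : ∀ x y, ⟪Q x, y⟫ = ⟪x, Q y⟫ := hQ
  have hmeas := measurable_sq_enorm_weyl hW e Q
  have hflip : ∀ φ : Lp ℂ 2 (volume : Measure ℝ),
      ∫⁻ z in Z, ‖Q (W (-z.1) (-z.2) φ)‖ₑ ^ 2 = ∫⁻ z in -Z, ‖Q (W z.1 z.2 φ)‖ₑ ^ 2 := by
    intro φ
    rw [← (Measure.measurePreserving_neg (volume : Measure (ℝ × ℝ))).setLIntegral_comp_preimage
      hZ.neg (hmeas φ), Set.neg_preimage, neg_neg]
    rfl
  simp only [← hRT]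
  refine e.tsum_inner_eq_toReal (G := fun φ => ∫⁻ z in -Z, ‖Q (W z.1 z.2 φ)‖ₑ ^ 2) hR hsum
    (fun x y => ?_) (fun x => by simp) (fun φ => ?_)
  · rw [← lintegral_add_left (hmeas x), ← lintegral_const_mul' _ _ ENNReal.ofNat_ne_top]
    refine lintegral_mono fun z => ?_
    rw [map_add, map_add]
    calc ‖Q (W z.1 z.2 x) + Q (W z.1 z.2 y)‖ₑ ^ 2
        ≤ (‖Q (W z.1 z.2 x)‖ₑ + ‖Q (W z.1 z.2 y)‖ₑ) ^ 2 := by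
          gcongr
          exact enorm_add_le _ _
      _ ≤ 2 * (‖Q (W z.1 z.2 x)‖ₑ ^ 2 + ‖Q (W z.1 z.2 y)‖ₑ ^ 2) := by
          have := ENNReal.rpow_add_le_mul_rpow_add_rpow ‖Q (W z.1 z.2 x)‖ₑ ‖Q (W z.1 z.2 y)‖ₑ
            (p := 2) (by norm_num)
          norm_num at this
          exact this
  · have hint : ∀ z : ℝ × ℝ, ⟪(ContinuousLinearMap.adjoint (W z.1 z.2)) φ,
          S ((ContinuousLinearMap.adjoint (W z.1 z.2)) φ)⟫
        = ((‖Q (W (-z.1) (-z.2) φ)‖ ^ 2 : ℝ) : ℂ) := by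
      intro z
      rw [adjoint_weyl hW, ← hQS, ← hQ', inner_self_eq_norm_sq_to_K]
      norm_cast
    have hm : Measurable fun z : ℝ × ℝ => ‖Q (W (-z.1) (-z.2) φ)‖ ^ 2 := by
      have := ((hmeas φ).comp measurable_neg).ennreal_toReal
      simpa using this
    rw [hE]
    simp only [hint]
    rw [integral_complex_ofReal, integral_eq_lintegral_of_nonneg_ae
      (Filter.Eventually.of_forall fun z => by positivity) hm.aestronglyMeasurable, ← hflip]
    simp [ENNReal.ofReal_pow]

end WeylOperators

/-- For positive trace-one operators `T, S` on `L²(ℝ)` and any Borel `Z ⊆ ℝ²`: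
`Tr[T E^S(Z)] = Tr[S E^T(−Z)]`, where `E^S`, `E^T` are the covariant phase space
observables generated by `S` and `T` (given through their defining weak integrals),
and traces are computed in a Hilbert basis `e`. -/
theorem trace_phaseSpace_symmetry
    (W : ℝ → ℝ → (Lp ℂ 2 (volume : Measure ℝ) →L[ℂ] Lp ℂ 2 (volume : Measure ℝ)))
    (hW : ∀ (q p : ℝ) (f : Lp ℂ 2 (volume : Measure ℝ)),
      (W q p f : ℝ → ℂ) =ᵐ[volume] weylOp q p f)
    (S T : Lp ℂ 2 (volume : Measure ℝ) →L[ℂ] Lp ℂ 2 (volume : Measure ℝ))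
    (hSpos : S.IsPositive) (hTpos : T.IsPositive)
    (e : HilbertBasis ℕ ℂ (Lp ℂ 2 (volume : Measure ℝ)))
    (htrS : (∑' n : ℕ, ⟪e n, S (e n)⟫) = 1) (htrT : (∑' n : ℕ, ⟪e n, T (e n)⟫) = 1)
    (ES ET : Set (ℝ × ℝ) → (Lp ℂ 2 (volume : Measure ℝ) →L[ℂ] Lp ℂ 2 (volume : Measure ℝ)))
    (hES : ∀ Z : Set (ℝ × ℝ), MeasurableSet Z → ∀ φ : Lp ℂ 2 (volume : Measure ℝ),
      ⟪φ, ES Z φ⟫ = (1 / (2 * Real.pi) : ℝ) *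
        ∫ z in Z, ⟪(ContinuousLinearMap.adjoint (W z.1 z.2)) φ,
          S ((ContinuousLinearMap.adjoint (W z.1 z.2)) φ)⟫)
    (hET : ∀ Z : Set (ℝ × ℝ), MeasurableSet Z → ∀ φ : Lp ℂ 2 (volume : Measure ℝ),
      ⟪φ, ET Z φ⟫ = (1 / (2 * Real.pi) : ℝ) *
        ∫ z in Z, ⟪(ContinuousLinearMap.adjoint (W z.1 z.2)) φ,
          T ((ContinuousLinearMap.adjoint (W z.1 z.2)) φ)⟫)
    (Z : Set (ℝ × ℝ)) (hZ : MeasurableSet Z) :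
    (∑' n : ℕ, ⟪e n, T (ES Z (e n))⟫) = ∑' n : ℕ, ⟪e n, S (ET (-Z) (e n))⟫ := by
  obtain ⟨Q, hQ, hQS⟩ := hSpos.exists_symmetric_sqrt
  obtain ⟨R, hR, hRT⟩ := hTpos.exists_symmetric_sqrt
  have hQsum := summable_sq_norm_of_tsum_inner_ne_zero hQ hQS (by rw [htrS]; exact one_ne_zero)
  have hRsum := summable_sq_norm_of_tsum_inner_ne_zero hR hRT (by rw [htrT]; exact one_ne_zero)
  rw [tsum_inner_phaseSpace hW e hQ hR hQS hRT hRsum hZ (hES Z hZ),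
    tsum_inner_phaseSpace hW e hR hQ hRT hQS hQsum hZ.neg (hET (-Z) hZ.neg), neg_neg,
    tsum_lintegral_weyl_exchange hW e hQ hR hZ]
end
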